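/- arXiv:1706.00572 — 2 statements merged into one kernel-verified Lean document; each statement's English description precedes it below -/
import Mathlib

section
/- Let A be a division ring with a valuation v : A → ℤ ∪ {∞} (meaning v(x) = ∞ iff x = 0, v(xy) = v(x) + v(y), and v(x + y) ≥ min{v(x), v(y)}), and assume there exists γ ∈ A with v(γ) = 1. Let R ⊆ A be a subring such that v(x) ≥ 0 for all x ∈ R, such that every x ∈ R with v(x) = 0 has its inverse x⁻¹ in R, and such that for some integer n ≥ 1 every x ∈ A with v(x) ≥ n lies in R. Then: (1) every atom u of the monoid R• := R \ {0} satisfies 1 ≤ v(u) ≤ 2n − 1; and (2) whenever u₁⋯u_k = v₁⋯v_l with all u_i and v_j atoms of R•, one has l ≤ (2n − 1)·k; in particular the elasticity of R• is at most 2n − 1, and hence finite. -/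
/-- `u` is an atom of the monoid `R• = R \ {0}` of nonzero elements of a subring `R`
of a division ring: a nonzero non-unit (unit = element with a two-sided inverse in `R`)
that is not a product of two nonzero non-units of `R`. -/
def SubringAtom {A : Type*} [DivisionRing A] (R : Subring A) (u : A) : Prop :=
  u ∈ R ∧ u ≠ 0 ∧ ¬ (∃ w ∈ R, u * w = 1 ∧ w * u = 1) ∧
    ∀ b c : A, b ∈ R → c ∈ R → b ≠ 0 → c ≠ 0 →
      ¬ (∃ w ∈ R, b * w = 1 ∧ w * b = 1) → ¬ (∃ w ∈ R, c * w = 1 ∧ w * c = 1) →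
      u ≠ b * c

theorem exists_int_of_add_valuation {A : Type*} [DivisionRing A] {v : A → WithTop ℤ}
    (hv0 : ∀ x : A, v x = ⊤ ↔ x = 0) {x : A} (hx : x ≠ 0) : ∃ m : ℤ, v x = m := by
  obtain ⟨m, hm⟩ := WithTop.ne_top_iff_exists.mp (fun h => hx ((hv0 x).mp h))
  exact ⟨m, hm.symm⟩

theorem add_valuation_one {A : Type*} [DivisionRing A] {v : A → WithTop ℤ}
    (hv0 : ∀ x : A, v x = ⊤ ↔ x = 0) (hvmul : ∀ x y : A, v (x * y) = v x + v y) :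
    v 1 = 0 := by
  obtain ⟨m, hm⟩ := exists_int_of_add_valuation hv0 (one_ne_zero (α := A))
  have h := hvmul 1 1
  rw [mul_one, hm] at h
  have h' : m = m + m := by exact_mod_cast h
  rw [hm, show m = 0 by omega]
  rfl

theorem add_valuation_pow {A : Type*} [DivisionRing A] {v : A → WithTop ℤ}
    (hv0 : ∀ x : A, v x = ⊤ ↔ x = 0) (hvmul : ∀ x y : A, v (x * y) = v x + v y)
    {γ : A} (hγ : v γ = 1) (n : ℕ) : v (γ ^ n) = ((n : ℤ) : WithTop ℤ) := by
  induction n with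
  | zero => simpa using add_valuation_one hv0 hvmul
  | succ k ih => rw [pow_succ, hvmul, ih, hγ]; push_cast; rfl

/-- Elements of positive valuation are not units of a subring on which `v` is nonnegative. -/
theorem not_unit_of_add_valuation_pos {A : Type*} [DivisionRing A] {v : A → WithTop ℤ}
    (hv0 : ∀ x : A, v x = ⊤ ↔ x = 0) (hvmul : ∀ x y : A, v (x * y) = v x + v y)
    {R : Subring A} (hR0 : ∀ x ∈ R, 0 ≤ v x) {b : A} (hb : 1 ≤ v b) :
    ¬ ∃ w ∈ R, b * w = 1 ∧ w * b = 1 := by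
  rintro ⟨w, hw, hbw, -⟩
  have h : (1 : WithTop ℤ) ≤ v b + v w := by simpa using add_le_add hb (hR0 w hw)
  rw [← hvmul, hbw, add_valuation_one hv0 hvmul] at h
  exact absurd h (by decide)

theorem SubringAtom.exists_add_valuation_eq {A : Type*} [DivisionRing A] {v : A → WithTop ℤ}
    (hv0 : ∀ x : A, v x = ⊤ ↔ x = 0) (hvmul : ∀ x y : A, v (x * y) = v x + v y)
    {γ : A} (hγ : v γ = 1) {R : Subring A} {n : ℕ} (hn : 1 ≤ n)
    (hR0 : ∀ x ∈ R, 0 ≤ v x) (hRinv : ∀ x ∈ R, v x = 0 → x⁻¹ ∈ R)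
    (hRn : ∀ x : A, ((n : ℤ) : WithTop ℤ) ≤ v x → x ∈ R) {u : A} (hu : SubringAtom R u) :
    ∃ m : ℤ, v u = m ∧ 1 ≤ m ∧ m ≤ 2 * (n : ℤ) - 1 := by
  obtain ⟨huR, hu0, hunit, hatom⟩ := hu
  obtain ⟨m, hm⟩ := exists_int_of_add_valuation hv0 hu0
  refine ⟨m, hm, ?_, ?_⟩
  · have h0 : 0 ≤ m := by
      have h := hR0 u huR
      rw [hm] at h
      exact_mod_cast h
    have h1 : m ≠ 0 := by
      rintro rfl
      exact hunit ⟨u⁻¹, hRinv u huR hm, mul_inv_cancel₀ hu0, inv_mul_cancel₀ hu0⟩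
    omega
  · by_contra! hlt
    have hγ0 : γ ≠ 0 := by
      rintro rfl
      rw [(hv0 0).mpr rfl] at hγ
      exact absurd hγ (by decide)
    have hb0 : γ ^ n ≠ 0 := pow_ne_zero n hγ0
    have hb := add_valuation_pow hv0 hvmul hγ n
    have hc0 : (γ ^ n)⁻¹ * u ≠ 0 := mul_ne_zero (inv_ne_zero hb0) hu0
    have huc : u = γ ^ n * ((γ ^ n)⁻¹ * u) := (mul_inv_cancel_left₀ hb0 u).symm
    obtain ⟨k, hk⟩ := exists_int_of_add_valuation hv0 hc0
    have hmk : m = n + k := by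
      have h := hvmul (γ ^ n) ((γ ^ n)⁻¹ * u)
      rw [← huc, hm, hb, hk] at h
      exact_mod_cast h
    have hnk : (n : ℤ) ≤ k := by omega
    have hn1 : (1 : WithTop ℤ) ≤ ((n : ℤ) : WithTop ℤ) := by exact_mod_cast hn
    have hcn : ((n : ℤ) : WithTop ℤ) ≤ v ((γ ^ n)⁻¹ * u) := by
      rw [hk]
      exact WithTop.coe_le_coe.mpr hnk
    exact hatom _ _ (hRn _ hb.ge) (hRn _ hcn) hb0 hc0
      (not_unit_of_add_valuation_pos hv0 hvmul hR0 (hb ▸ hn1))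
      (not_unit_of_add_valuation_pos hv0 hvmul hR0 (hn1.trans hcn)) huc

/-- If every element of a list has valuation in `[1, N]`, then the valuation of the product
lies between the length and `N` times the length. -/
theorem exists_add_valuation_list_prod_eq {A : Type*} [DivisionRing A] {v : A → WithTop ℤ}
    (hv0 : ∀ x : A, v x = ⊤ ↔ x = 0) (hvmul : ∀ x y : A, v (x * y) = v x + v y)
    {N : ℤ} (l : List A) (hl : ∀ u ∈ l, ∃ m : ℤ, v u = m ∧ 1 ≤ m ∧ m ≤ N) :
    ∃ m : ℤ, v l.prod = m ∧ (l.length : ℤ) ≤ m ∧ m ≤ N * l.length := by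
  induction l with
  | nil => exact ⟨0, by simpa using add_valuation_one hv0 hvmul, by simp, by simp⟩
  | cons a t ih =>
    obtain ⟨p, hp, hp1, hpN⟩ := hl a (by simp)
    obtain ⟨q, hq, hq1, hqN⟩ := ih fun u hu => hl u (List.mem_cons_of_mem a hu)
    refine ⟨p + q, ?_, ?_, ?_⟩
    · rw [List.prod_cons, hvmul, hp, hq]
      rfl
    · rw [List.length_cons]
      push_cast
      omega
    · rw [List.length_cons]
      push_cast
      linarith

/-- let `A` be a division ring with a valuation `v : A → ℤ ∪ {∞}`,
`γ ∈ A` with `v γ = 1`, and `R ⊆ A` a subring with `v ≥ 0` on `R`, closed under inverses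
of valuation-zero elements, and containing every `x` with `v x ≥ n` (`n ≥ 1`).  Then every
atom `u` of `R•` satisfies `1 ≤ v u ≤ 2n − 1`, and whenever `u₁⋯u_k = v₁⋯v_l` with all
factors atoms of `R•` one has `l ≤ (2n−1)·k`; in particular the elasticity of `R•` is at
most `2n − 1`, hence finite. -/
theorem subring_of_valued_division_ring_elasticity {A : Type*} [DivisionRing A]
    (v : A → WithTop ℤ)
    (hv0 : ∀ x : A, v x = ⊤ ↔ x = 0)
    (hvmul : ∀ x y : A, v (x * y) = v x + v y)
    (hvadd : ∀ x y : A, min (v x) (v y) ≤ v (x + y))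
    (γ : A) (hγ : v γ = 1)
    (R : Subring A) (n : ℕ) (hn : 1 ≤ n)
    (hR0 : ∀ x ∈ R, 0 ≤ v x)
    (hRinv : ∀ x ∈ R, v x = 0 → x⁻¹ ∈ R)
    (hRn : ∀ x : A, ((n : ℤ) : WithTop ℤ) ≤ v x → x ∈ R) :
    (∀ u : A, SubringAtom R u → 1 ≤ v u ∧ v u ≤ ((2 * (n : ℤ) - 1 : ℤ) : WithTop ℤ)) ∧
    (∀ l₁ l₂ : List A, (∀ u ∈ l₁, SubringAtom R u) → (∀ u ∈ l₂, SubringAtom R u) →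
      l₁.prod = l₂.prod → l₂.length ≤ (2 * n - 1) * l₁.length) := by
  have hatom := fun u (hu : SubringAtom R u) =>
    hu.exists_add_valuation_eq hv0 hvmul hγ hn hR0 hRinv hRn
  refine ⟨fun u hu => ?_, fun l₁ l₂ h₁ h₂ heq => ?_⟩
  · obtain ⟨m, hm, h1, h2⟩ := hatom u hu
    rw [hm]
    exact ⟨by exact_mod_cast h1, WithTop.coe_le_coe.mpr h2⟩
  · obtain ⟨p, hp, -, hpN⟩ :=
      exists_add_valuation_list_prod_eq hv0 hvmul l₁ fun u hu => hatom u (h₁ u hu)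
    obtain ⟨q, hq, hq1, -⟩ :=
      exists_add_valuation_list_prod_eq hv0 hvmul l₂ fun u hu => hatom u (h₂ u hu)
    have hpq : p = q := by
      rw [heq, hq] at hp
      exact_mod_cast hp.symm
    zify [show 1 ≤ 2 * n by omega]
    linarith
end

section
/- Let H be an atomic cancellative monoid (every non-unit of H is a finite product of atoms), let J ⊆ H satisfy H·J ⊆ J and J·H ⊆ J, and let N ≥ 1 be an integer such that: (1) for every a ∈ H \ J, the set of lengths L(a) is a singleton; (2) whenever u₁⋯u_k ∈ J with k ≥ N + 1 and all u_i atoms of H, there exist l ∈ [1, N+1] and i ∈ [1, k−l+1] such that the consecutive subproduct u_i·u_{i+1}⋯u_{i+l−1} lies in J; and (3) every a ∈ J can be written as a unit of H times a product of at most N atoms. Then every d ∈ Δ(H) satisfies d ≤ N − 1, and if J contains a non-unit of H then the elasticity of H is infinite: for every C ∈ ℕ there exist a ∈ H and k, l ∈ L(a) with l > C·k. -/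
/-- An atom of a monoid: a non-unit that is not a product of two non-units. -/
def MonAtom {H : Type*} [Monoid H] (u : H) : Prop :=
  ¬ IsUnit u ∧ ∀ b c : H, u = b * c → IsUnit b ∨ IsUnit c

/-- The set of lengths of `a`: `k ∈ L(a)` iff `a = ε·u₁⋯u_k` for a unit `ε` and atoms
`u₁, …, u_k`. -/
def MonLengths {H : Type*} [Monoid H] (a : H) : Set ℕ :=
  {k | ∃ (ε : H) (l : List H), IsUnit ε ∧ (∀ u ∈ l, MonAtom u) ∧ l.length = k ∧
    a = ε * l.prod}

/-- The set of distances `Δ(H)`: all `d ≥ 1` such that for some `a ∈ H` there are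
`k < l` in `L(a)` with `l − k = d` and `L(a) ∩ [k, l] = {k, l}`. -/
def MonDelta (H : Type*) [Monoid H] : Set ℕ :=
  {d | 1 ≤ d ∧ ∃ a : H, ∃ k l : ℕ, k ∈ MonLengths a ∧ l ∈ MonLengths a ∧ k < l ∧
    l - k = d ∧ ∀ m ∈ MonLengths a, k ≤ m → m ≤ l → m = k ∨ m = l}

theorem MonAtom.unit_mul {H : Type*} [CancelMonoid H] {ε u : H} (hε : IsUnit ε)
    (hu : MonAtom u) : MonAtom (ε * u) := by
  refine ⟨fun h => hu.1 (isUnit_of_mul_isUnit_right h), fun b c hbc => ?_⟩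
  obtain ⟨w, rfl⟩ := hε
  have h : u = ↑w⁻¹ * b * c := by rw [mul_assoc, ← hbc, Units.inv_mul_cancel_left]
  exact (hu.2 _ _ h).imp_left isUnit_of_mul_isUnit_right

theorem not_isUnit_prod_of_monAtom {H : Type*} [CancelMonoid H] {l : List H}
    (hl : ∀ u ∈ l, MonAtom u) (hne : l ≠ []) : ¬ IsUnit l.prod := by
  cases l with
  | nil => exact absurd rfl hne
  | cons b t =>
    rw [List.prod_cons]
    exact fun h => (hl b (by simp)).1 (isUnit_of_mul_isUnit_left h)

theorem not_monAtom_prod_of_two_le_length {H : Type*} [CancelMonoid H] {l : List H}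
    (hl : ∀ u ∈ l, MonAtom u) (h2 : 2 ≤ l.length) : ¬ MonAtom l.prod := by
  match l, h2 with
  | b :: c :: t, _ =>
    intro h
    rcases h.2 b (c :: t).prod (by simp) with h | h
    · exact (hl b (by simp)).1 h
    · exact not_isUnit_prod_of_monAtom
        (fun u hu => hl u (List.mem_cons_of_mem b hu)) (by simp) h

theorem exists_atoms_prod_eq_unit_mul_prod {H : Type*} [CancelMonoid H] {ε : H} (hε : IsUnit ε)
    {l : List H} (hl : ∀ u ∈ l, MonAtom u) (hne : l ≠ []) :
    ∃ l' : List H, (∀ u ∈ l', MonAtom u) ∧ l'.length = l.length ∧ l'.prod = ε * l.prod := by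
  cases l with
  | nil => exact absurd rfl hne
  | cons b t =>
    refine ⟨(ε * b) :: t, ?_, by simp, by simp [mul_assoc]⟩
    intro u hu
    rcases List.mem_cons.1 hu with rfl | hu
    · exact (hl b (by simp)).unit_mul hε
    · exact hl u (List.mem_cons_of_mem b hu)

theorem MonLengths.pos_of_not_isUnit {H : Type*} [Monoid H] {a : H} (ha : ¬ IsUnit a) {k : ℕ}
    (hk : k ∈ MonLengths a) : 0 < k := by
  obtain ⟨ε, l, hε, -, rfl, rfl⟩ := hk
  refine List.length_pos_iff.2 fun h => ha ?_
  simpa [h] using hε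

/-- A short consecutive subproduct in a two-sided ideal extends to one of exactly `n` factors. -/
theorem exists_append_of_drop_take_prod_mem {H : Type*} [Monoid H] {J : Set H}
    (hJl : ∀ a : H, ∀ j ∈ J, a * j ∈ J) (hJr : ∀ a : H, ∀ j ∈ J, j * a ∈ J)
    {L : List H} {n i len : ℕ} (hn : n ≤ L.length) (hlen : len ≤ n) (hi : i + len ≤ L.length)
    (h : ((L.drop i).take len).prod ∈ J) :
    ∃ A B C : List H, L = A ++ B ++ C ∧ B.length = n ∧ B.prod ∈ J := by
  obtain ⟨s, hsi, hsn, his⟩ : ∃ s, s ≤ i ∧ s + n ≤ L.length ∧ i + len ≤ s + n :=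
    ⟨min i (L.length - n), by omega, by omega, by omega⟩
  refine ⟨L.take s, (L.drop s).take n, (L.drop s).drop n, ?_, ?_, ?_⟩
  · rw [List.append_assoc, List.take_append_drop, List.take_append_drop]
  · rw [List.length_take, List.length_drop]
    omega
  · have key : (((L.drop s).take n).drop (i - s)).take len = (L.drop i).take len := by
      rw [List.drop_take, List.take_take, List.drop_drop, Nat.add_sub_cancel' hsi,
        min_eq_left (by omega)]
    rw [← List.prod_take_mul_prod_drop ((L.drop s).take n) (i - s)]
    apply hJl
    rw [← List.prod_take_mul_prod_drop (((L.drop s).take n).drop (i - s)) len, key]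
    exact hJr _ _ h

theorem exists_mem_monLengths_of_split {H : Type*} [CancelMonoid H] {N : ℕ} (hN : 1 ≤ N) {ε ε' : H} {A B C B' : List H} (hε : IsUnit ε) (hε' : IsUnit ε')
    (hL : ∀ u ∈ A ++ B ++ C, MonAtom u) (hB' : ∀ u ∈ B', MonAtom u)
    (hlen : B.length = N + 1) (hBB' : B.prod = ε' * B'.prod) :
    2 ≤ B'.length ∧ A.length + B'.length + C.length ∈ MonLengths (ε * (A ++ B ++ C).prod) := by
  have hB : ∀ u ∈ B, MonAtom u := fun u hu => hL u (by simp [hu])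
  have hBne : B ≠ [] := by
    rintro rfl
    simp at hlen
  have hB'ne : B' ≠ [] := by
    rintro rfl
    exact not_isUnit_prod_of_monAtom hB hBne (by simpa [hBB'] using hε')
  obtain ⟨B₁, hB₁, hB₁len, hB₁prod⟩ := exists_atoms_prod_eq_unit_mul_prod hε' hB' hB'ne
  constructor
  · by_contra! hlt
    have h1 : B₁.length = 1 := by
      have := List.length_pos_iff.2 hB'ne
      omega
    obtain ⟨b, rfl⟩ := List.length_eq_one_iff.1 h1
    refine not_monAtom_prod_of_two_le_length hB (by omega) ?_
    rw [hBB', ← hB₁prod, List.prod_singleton]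
    exact hB₁ b (by simp)
  · refine ⟨ε, A ++ B₁ ++ C, hε, ?_, by simp [hB₁len, add_assoc], by
      simp only [List.prod_append, hB₁prod, hBB']⟩
    intro u hu
    rcases List.mem_append.1 hu with hu | hu
    · rcases List.mem_append.1 hu with hu | hu
      · exact hL u (by simp [hu])
      · exact hB₁ u hu
    · exact hL u (by simp [hu])

/-- let `H` be an atomic cancellative monoid, `J ⊆ H` with
`H·J ⊆ J` and `J·H ⊆ J`, and `N ≥ 1` such that (1) `L(a)` is a singleton for `a ∉ J`;
(2) any product of `k ≥ N+1` atoms lying in `J` has a consecutive subproduct of length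
`l ∈ [1, N+1]` lying in `J`; (3) every `a ∈ J` is a unit times a product of at most `N`
atoms.  Then `max Δ(H) ≤ N − 1`, and if `J` contains a non-unit then the elasticity of
`H` is infinite. -/
theorem delta_bound_and_infinite_elasticity {H : Type*} [CancelMonoid H]
    (hatomic : ∀ a : H, ¬ IsUnit a → ∃ l : List H, (∀ u ∈ l, MonAtom u) ∧ a = l.prod)
    (J : Set H)
    (hJl : ∀ a : H, ∀ j ∈ J, a * j ∈ J) (hJr : ∀ a : H, ∀ j ∈ J, j * a ∈ J)
    (N : ℕ) (hN : 1 ≤ N)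
    (h1 : ∀ a : H, a ∉ J → ∃ k : ℕ, MonLengths a = {k})
    (h2 : ∀ l : List H, (∀ u ∈ l, MonAtom u) → l.prod ∈ J → N + 1 ≤ l.length →
      ∃ i len : ℕ, 1 ≤ len ∧ len ≤ N + 1 ∧ i + len ≤ l.length ∧
        ((l.drop i).take len).prod ∈ J)
    (h3 : ∀ a ∈ J, ∃ (ε : H) (l : List H), IsUnit ε ∧ (∀ u ∈ l, MonAtom u) ∧
      l.length ≤ N ∧ a = ε * l.prod) :
    (∀ d ∈ MonDelta H, d ≤ N - 1) ∧
    ((∃ a ∈ J, ¬ IsUnit a) → ∀ C : ℕ, ∃ (a : H) (k l : ℕ),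
      k ∈ MonLengths a ∧ l ∈ MonLengths a ∧ C * k < l) := by
  constructor
  · rintro d ⟨-, a, k, l, hk, hl, hkl, rfl, hgap⟩
    have haJ : a ∈ J := by
      by_contra ha
      obtain ⟨m, hm⟩ := h1 a ha
      rw [hm, Set.mem_singleton_iff] at hk hl
      omega
    obtain ⟨ε, L, hε, hL, rfl, rfl⟩ := hl
    have hau : ¬ IsUnit (ε * L.prod) := fun h =>
      not_isUnit_prod_of_monAtom hL (List.length_pos_iff.1 (by omega))
        (isUnit_of_mul_isUnit_right h)
    have hk0 := MonLengths.pos_of_not_isUnit hau hk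
    by_contra! hd
    have hLJ : L.prod ∈ J := by
      obtain ⟨w, rfl⟩ := hε
      simpa using hJl (↑w⁻¹ : H) _ haJ
    obtain ⟨i, len, -, hlen, hi, hmem⟩ := h2 L hL hLJ (by omega)
    obtain ⟨A, B, C, rfl, hBlen, hBJ⟩ :=
      exists_append_of_drop_take_prod_mem hJl hJr (by omega) hlen hi hmem
    obtain ⟨ε', B', hε', hB', hB'len, hBB'⟩ := h3 _ hBJ
    obtain ⟨h2le, hmemL⟩ := exists_mem_monLengths_of_split hN hε hε' hL hB' hBlen hBB'
    simp only [List.length_append] at hgap hd hkl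
    have := hgap _ hmemL (by omega) (by omega)
    omega
  · rintro ⟨a, haJ, ha⟩ C
    have hpow : a ^ (C * N + 1) ∈ J := by
      rw [pow_succ]
      exact hJl _ _ haJ
    obtain ⟨ε, L, hε, hL, hLN, hprod⟩ := h3 _ hpow
    obtain ⟨l, hl, rfl⟩ := hatomic a ha
    have hl0 : 1 ≤ l.length := by
      refine List.length_pos_iff.2 fun h => ha ?_
      simp [h]
    refine ⟨_, L.length, (C * N + 1) * l.length, ⟨ε, L, hε, hL, rfl, hprod⟩,
      ⟨1, (List.replicate (C * N + 1) l).flatten, isUnit_one, ?_, by simp, by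
        simp [List.prod_flatten]⟩, ?_⟩
    · intro u hu
      obtain ⟨t, ht, hut⟩ := List.mem_flatten.1 hu
      rw [List.eq_of_mem_replicate ht] at hut
      exact hl u hut
    · calc C * L.length ≤ C * N := Nat.mul_le_mul_left C hLN
        _ < C * N + 1 := Nat.lt_succ_self _
        _ ≤ (C * N + 1) * l.length := Nat.le_mul_of_pos_right _ hl0
end
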